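/- arXiv:2004.14279 — 4 statements merged into one kernel-verified Lean document; each statement's English description precedes it below -/
import Mathlib

section
/- Let v ≥ 0 and for x > 0 define K_v(x) = π^{-1/2} Γ(v+1/2) (2x)^v ∫₀^∞ cos(t) · (t²+x²)^{-(v+1/2)} dt. Then K_v is twice differentiable on (0,∞) and satisfies the modified Bessel differential equation x² K_v''(x) + x K_v'(x) − (x² + v²) K_v(x) = 0 for all x > 0. -/
open Real MeasureTheory Set

/-- The modified Bessel function of the second kind for real argument `x > 0`,
defined via the integral representation. -/
noncomputable def besselK (v : ℝ) (x : ℝ) : ℝ :=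
  Real.pi ^ (-(1 : ℝ)/2) * Real.Gamma (v + 1/2) * (2*x) ^ v *
    ∫ t in Set.Ioi (0:ℝ), Real.cos t * (t^2 + x^2) ^ (-(v + 1/2))

open Filter Topology

lemma continuous_sq_add_sq_rpow {x : ℝ} (hx : 0 < x) (p : ℝ) :
    Continuous fun t : ℝ => (t ^ 2 + x ^ 2) ^ p :=
  Continuous.rpow_const (by fun_prop) fun t => Or.inl (by positivity)

lemma integrable_sq_add_sq_rpow_neg {x a : ℝ} (hx : 0 < x) (ha : 1 / 2 < a) :
    Integrable fun t : ℝ => (t ^ 2 + x ^ 2) ^ (-a) := by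
  have h1 : Integrable fun t : ℝ => ((1 : ℝ) + ‖t‖ ^ 2) ^ (-(2 * a) / 2) :=
    integrable_rpow_neg_one_add_norm_sq (by simp; linarith)
  have h2 := h1.const_mul ((min 1 (x ^ 2)) ^ (-a))
  refine h2.mono' (continuous_sq_add_sq_rpow hx _).aestronglyMeasurable
    (Eventually.of_forall fun t => ?_)
  have hm : 0 < min 1 (x ^ 2) := lt_min one_pos (by positivity)
  rw [Real.norm_of_nonneg (by positivity), Real.norm_eq_abs, sq_abs,
    show -(2 * a) / 2 = -a by ring, ← Real.mul_rpow hm.le (by positivity)]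
  refine Real.rpow_le_rpow_of_nonpos (by positivity) ?_ (by linarith)
  nlinarith [min_le_left 1 (x ^ 2), min_le_right 1 (x ^ 2), sq_nonneg t]

lemma integrable_cos_mul_sq_add_sq_rpow_neg {x a : ℝ} (hx : 0 < x) (ha : 1 / 2 < a) :
    Integrable fun t : ℝ => Real.cos t * (t ^ 2 + x ^ 2) ^ (-a) := by
  refine (integrable_sq_add_sq_rpow_neg hx ha).mono'
    (Real.continuous_cos.mul (continuous_sq_add_sq_rpow hx _)).aestronglyMeasurable
    (Eventually.of_forall fun t => ?_)
  have h : 0 ≤ (t ^ 2 + x ^ 2) ^ (-a) := by positivity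
  rw [norm_mul, Real.norm_of_nonneg h]
  exact mul_le_of_le_one_left h (Real.abs_cos_le_one t)

/-- The cosine integral `∫₀^∞ cos t · (t² + x²)^{-a} dt`. -/
noncomputable def cosIntegral (a x : ℝ) : ℝ :=
  ∫ t in Ioi (0 : ℝ), Real.cos t * (t ^ 2 + x ^ 2) ^ (-a)

lemma hasDerivAt_cosIntegral {a x : ℝ} (ha : 1 / 2 < a) (hx : 0 < x) :
    HasDerivAt (cosIntegral a) (-2 * a * x * cosIntegral (a + 1) x) x := by
  have hs : Ioo (x / 2) (2 * x) ∈ 𝓝 x := Ioo_mem_nhds (by linarith) (by linarith)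
  have key := hasDerivAt_integral_of_dominated_loc_of_deriv_le
    (μ := volume.restrict (Ioi (0 : ℝ)))
    (F := fun y t => Real.cos t * (t ^ 2 + y ^ 2) ^ (-a))
    (F' := fun y t => -2 * a * y * (Real.cos t * (t ^ 2 + y ^ 2) ^ (-(a + 1))))
    (bound := fun t => 2 * a * (2 * x) * (t ^ 2 + (x / 2) ^ 2) ^ (-(a + 1))) hs
    ?_ (integrable_cos_mul_sq_add_sq_rpow_neg hx ha).integrableOn ?_ ?_ ?_ ?_
  · have h := key.2
    rwa [integral_const_mul] at h
  · filter_upwards [hs] with y hy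
    have hy0 : 0 < y := by linarith [hy.1]
    exact (integrable_cos_mul_sq_add_sq_rpow_neg hy0 ha).integrableOn.aestronglyMeasurable
  · exact ((integrable_cos_mul_sq_add_sq_rpow_neg hx
      (by linarith : 1 / 2 < a + 1)).const_mul _).integrableOn.aestronglyMeasurable
  · refine Eventually.of_forall fun t y hy => ?_
    have hy0 : 0 < y := by linarith [hy.1]
    have h0 : (0 : ℝ) ≤ (t ^ 2 + y ^ 2) ^ (-(a + 1)) := by positivity
    have h1 : (t ^ 2 + y ^ 2) ^ (-(a + 1)) ≤ (t ^ 2 + (x / 2) ^ 2) ^ (-(a + 1)) := by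
      refine Real.rpow_le_rpow_of_nonpos (by positivity) ?_ (by linarith)
      nlinarith [hy.1]
    have h2 : ‖-2 * a * y‖ = 2 * a * y := by
      rw [Real.norm_eq_abs, abs_of_nonpos] <;> nlinarith
    rw [norm_mul, h2, norm_mul, Real.norm_of_nonneg h0]
    have h3 : ‖Real.cos t‖ * (t ^ 2 + y ^ 2) ^ (-(a + 1)) ≤ (t ^ 2 + (x / 2) ^ 2) ^ (-(a + 1)) :=
      (mul_le_of_le_one_left h0 (Real.abs_cos_le_one t)).trans h1
    refine mul_le_mul ?_ h3 (by positivity) (by nlinarith)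
    nlinarith [hy.2]
  · exact ((integrable_sq_add_sq_rpow_neg (by linarith : 0 < x / 2)
      (by linarith : 1 / 2 < a + 1)).const_mul _).integrableOn
  · refine Eventually.of_forall fun t y hy => ?_
    have hy0 : 0 < y := by linarith [hy.1]
    have h := (((hasDerivAt_pow 2 y).const_add (t ^ 2)).rpow_const (p := -a)
      (Or.inl (by positivity))).const_mul (Real.cos t)
    refine h.congr_deriv ?_
    rw [show -a - 1 = -(a + 1) by ring]
    push_cast
    ring

lemma tendsto_sq_add_sq_rpow_neg {a : ℝ} (x : ℝ) (ha : 0 < a) :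
    Tendsto (fun t : ℝ => (t ^ 2 + x ^ 2) ^ (-a)) atTop (𝓝 0) :=
  (tendsto_rpow_neg_atTop ha).comp
    (tendsto_atTop_add_const_right _ _ (tendsto_pow_atTop two_ne_zero))

lemma hasDerivAt_sq_add_sq_rpow_neg {x : ℝ} (hx : 0 < x) (b t : ℝ) :
    HasDerivAt (fun t : ℝ => (t ^ 2 + x ^ 2) ^ (-b))
      (-2 * b * t * (t ^ 2 + x ^ 2) ^ (-(b + 1))) t := by
  have h := ((hasDerivAt_pow 2 t).add_const (x ^ 2)).rpow_const (p := -b)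
    (Or.inl (by positivity))
  refine h.congr_deriv ?_
  rw [show -b - 1 = -(b + 1) by ring]
  push_cast
  ring

/-- Two integrations by parts in the cosine integral. -/
lemma cosIntegral_recurrence {a x : ℝ} (ha : 1 / 2 < a) (hx : 0 < x) :
    cosIntegral a x + 2 * a * (2 * a + 1) * cosIntegral (a + 1) x
      - 4 * a * (a + 1) * x ^ 2 * cosIntegral (a + 2) x = 0 := by
  have i0 := (integrable_cos_mul_sq_add_sq_rpow_neg hx ha).integrableOn (s := Ioi 0)
  have i1 := ((integrable_cos_mul_sq_add_sq_rpow_neg hx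
    (by linarith : 1 / 2 < a + 1)).integrableOn (s := Ioi 0)).const_mul (2 * a * (2 * a + 1))
  have i2 := ((integrable_cos_mul_sq_add_sq_rpow_neg hx
    (by linarith : 1 / 2 < a + 2)).integrableOn (s := Ioi 0)).const_mul
      (4 * a * (a + 1) * x ^ 2)
  have key := integral_Ioi_of_hasDerivAt_of_tendsto' (a := 0) (m := 0)
    (f := fun t => Real.sin t * (t ^ 2 + x ^ 2) ^ (-a)
      + Real.cos t * (-2 * a * t * (t ^ 2 + x ^ 2) ^ (-(a + 1)))) ?_ ((i0.add i1).sub i2) ?_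
  · rw [integral_sub' (i0.add i1) i2, integral_add' i0 i1, integral_const_mul,
      integral_const_mul] at key
    simpa [cosIntegral] using key
  · intro t _
    have h1 := hasDerivAt_sq_add_sq_rpow_neg hx a t
    have h2 := hasDerivAt_sq_add_sq_rpow_neg hx (a + 1) t
    have h := ((Real.hasDerivAt_sin t).mul h1).add ((Real.hasDerivAt_cos t).mul
      (((hasDerivAt_id t).const_mul (-2 * a)).mul h2))
    refine h.congr_deriv ?_
    have hs : (t ^ 2 + x ^ 2) ^ (-(a + 1)) =
        (t ^ 2 + x ^ 2) ^ (-(a + 2)) * (t ^ 2 + x ^ 2) := by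
      rw [← Real.rpow_add_one (by positivity)]; congr 1; ring
    simp only [id, Pi.add_apply, Pi.sub_apply, Pi.mul_apply]
    rw [show a + 1 + 1 = a + 2 by ring, hs]
    ring
  · have hb := (tendsto_sq_add_sq_rpow_neg x (by linarith : 0 < a)).const_mul (1 + a / x)
    rw [mul_zero] at hb
    refine squeeze_zero_norm' ?_ hb
    filter_upwards [eventually_ge_atTop 0] with t ht
    set s := t ^ 2 + x ^ 2 with hs_def
    have hs : 0 < s := by positivity
    have hp : 0 ≤ s ^ (-a) := by positivity
    have hq : 0 ≤ s ^ (-(a + 1)) := by positivity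
    have e : s ^ (-a) = s ^ (-(a + 1)) * s := by
      rw [← Real.rpow_add_one hs.ne']; congr 1; ring
    have h1 : ‖Real.sin t * s ^ (-a)‖ ≤ s ^ (-a) := by
      rw [norm_mul, Real.norm_of_nonneg hp]
      exact mul_le_of_le_one_left hp (Real.abs_sin_le_one t)
    have h2 : ‖-2 * a * t * s ^ (-(a + 1))‖ ≤ a / x * s ^ (-a) := by
      have : ‖-2 * a * t * s ^ (-(a + 1))‖ = 2 * a * t * s ^ (-(a + 1)) := by
        rw [norm_mul, Real.norm_of_nonneg hq, Real.norm_eq_abs, abs_of_nonpos] <;> nlinarith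
      rw [this, e, div_mul_eq_mul_div, le_div_iff₀ hx]
      have h3 : 0 ≤ a * s ^ (-(a + 1)) := by positivity
      nlinarith [mul_nonneg h3 (sq_nonneg (t - x))]
    have h3 : ‖Real.cos t * (-2 * a * t * s ^ (-(a + 1)))‖ ≤ a / x * s ^ (-a) := by
      rw [norm_mul]
      exact (mul_le_of_le_one_left (norm_nonneg _) (Real.abs_cos_le_one t)).trans h2
    calc _ ≤ _ := norm_add_le _ _
      _ ≤ s ^ (-a) + a / x * s ^ (-a) := add_le_add h1 h3
      _ = _ := by ring

lemma inv_add_le_sq_add_sq_rpow {t x : ℝ} (ht : 0 ≤ t) (hx : 0 < x) :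
    (t + x)⁻¹ ≤ (t ^ 2 + x ^ 2) ^ (-(1 / 2 : ℝ)) := by
  rw [Real.rpow_neg (by positivity), ← Real.sqrt_eq_rpow]
  refine inv_anti₀ (by positivity) (Real.sqrt_le_iff.2 ⟨by positivity, ?_⟩)
  nlinarith [mul_nonneg ht hx.le]

lemma one_le_abs_sin_add_abs_cos (t : ℝ) : 1 ≤ |Real.sin t| + |Real.cos t| := by
  nlinarith [Real.sin_sq_add_cos_sq t, sq_abs (Real.sin t), sq_abs (Real.cos t),
    abs_nonneg (Real.sin t), abs_nonneg (Real.cos t), Real.abs_sin_le_one t,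
    Real.abs_cos_le_one t]

/-- At exponent `1/2` the cosine integral is not absolutely convergent. -/
lemma not_integrableOn_cos_mul_sq_add_sq_rpow_neg_half {x : ℝ} (hx : 0 < x) :
    ¬ IntegrableOn (fun t : ℝ => Real.cos t * (t ^ 2 + x ^ 2) ^ (-(1 / 2 : ℝ))) (Ioi 0) := by
  intro h
  have hshift := ((measurePreserving_add_right volume (π / 2)).integrableOn_comp_preimage
    (measurableEmbedding_addRight (π / 2))).2
      (h.mono_set (Ioi_subset_Ioi (by positivity : (0 : ℝ) ≤ π / 2)))
  have hpre : (fun t : ℝ => t + π / 2) ⁻¹' Ioi (π / 2) = Ioi 0 := by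
    ext t; simp
  rw [hpre] at hshift
  have hsum := IntegrableOn.mono_set ((h.norm.add hshift.norm).const_mul 2)
    (Ioi_subset_Ioi (by positivity : (0 : ℝ) ≤ 2 + x))
  refine not_integrableOn_Ioi_inv (a := 2 + x) (hsum.mono'
    measurable_inv.aestronglyMeasurable ?_)
  filter_upwards [ae_restrict_mem measurableSet_Ioi] with t ht
  have ht' : 2 + x < t := ht
  have ht0 : 0 < t := by linarith
  have b1 := inv_add_le_sq_add_sq_rpow ht0.le hx
  have b2 := inv_add_le_sq_add_sq_rpow (by positivity : 0 ≤ t + π / 2) hx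
  have hpi : π / 2 ≤ 2 := by linarith [Real.pi_le_four]
  have c1 : (2 * t)⁻¹ ≤ (t + x)⁻¹ := inv_anti₀ (by positivity) (by linarith)
  have c2 : (2 * t)⁻¹ ≤ (t + π / 2 + x)⁻¹ := inv_anti₀ (by positivity) (by linarith)
  simp only [Pi.add_apply, Function.comp, norm_mul, Real.norm_eq_abs, Real.cos_add_pi_div_two,
    abs_neg]
  rw [abs_of_nonneg (by positivity : 0 ≤ t⁻¹),
    abs_of_nonneg (by positivity : 0 ≤ (t ^ 2 + x ^ 2) ^ (-(1 / 2 : ℝ))),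
    abs_of_nonneg (by positivity : 0 ≤ ((t + π / 2) ^ 2 + x ^ 2) ^ (-(1 / 2 : ℝ)))]
  have d1 := mul_le_mul_of_nonneg_left (c1.trans b1) (abs_nonneg (Real.cos t))
  have d2 := mul_le_mul_of_nonneg_left (c2.trans b2) (abs_nonneg (Real.sin t))
  have d3 := mul_le_mul_of_nonneg_right (one_le_abs_sin_add_abs_cos t)
    (by positivity : 0 ≤ (2 * t)⁻¹)
  have d4 : t⁻¹ = 2 * (2 * t)⁻¹ := by field_simp
  rw [d4]
  linarith

lemma besselK_zero_eq_zero {x : ℝ} (hx : 0 < x) : besselK 0 x = 0 := by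
  have h := integral_undef (not_integrableOn_cos_mul_sq_add_sq_rpow_neg_half hx)
  simp only [besselK, zero_add]
  rw [h, mul_zero]

lemma hasDerivAt_two_mul_rpow {x : ℝ} (hx : 0 < x) (v : ℝ) :
    HasDerivAt (fun y : ℝ => (2 * y) ^ v) (v / x * (2 * x) ^ v) x := by
  have h := ((hasDerivAt_id x).const_mul 2).rpow_const (p := v)
    (Or.inl (by simp only [id]; positivity))
  refine h.congr_deriv ?_
  simp only [id]
  rw [Real.rpow_sub_one (by positivity)]
  field_simp

lemma hasDerivAt_besselK {v x : ℝ} (hv : 0 < v) (hx : 0 < x) :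
    HasDerivAt (besselK v) (v / x * besselK v x - π ^ (-(1 : ℝ) / 2) * Real.Gamma (v + 1 / 2)
      * (2 * v + 1) * (x * ((2 * x) ^ v * cosIntegral (v + 1 / 2 + 1) x))) x := by
  have h := ((hasDerivAt_two_mul_rpow hx v).const_mul
    (π ^ (-(1 : ℝ) / 2) * Real.Gamma (v + 1 / 2))).mul
      (hasDerivAt_cosIntegral (by linarith : 1 / 2 < v + 1 / 2) hx)
  refine h.congr_deriv ?_
  change _ = v / x * (π ^ (-(1 : ℝ) / 2) * Real.Gamma (v + 1 / 2) * (2 * x) ^ v *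
    cosIntegral (v + 1 / 2) x) - _
  ring

lemma hasDerivAt_deriv_besselK {v x : ℝ} (hv : 0 < v) (hx : 0 < x) :
    HasDerivAt (deriv (besselK v))
      ((1 + v ^ 2 / x ^ 2) * besselK v x - deriv (besselK v) x / x) x := by
  set C := π ^ (-(1 : ℝ) / 2) * Real.Gamma (v + 1 / 2) with hC
  have hev : deriv (besselK v) =ᶠ[𝓝 x] fun y => v / y * besselK v y -
      C * (2 * v + 1) * (y * ((2 * y) ^ v * cosIntegral (v + 1 / 2 + 1) y)) := by
    filter_upwards [Ioi_mem_nhds hx] with y hy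
    exact (hasDerivAt_besselK hv hy).deriv
  have hdiv : HasDerivAt (fun y : ℝ => v / y) (-v / x ^ 2) x := by
    have h := (hasDerivAt_inv hx.ne').const_mul v
    simp only [← div_eq_mul_inv] at h
    exact h.congr_deriv (by ring)
  have hK := hasDerivAt_besselK hv hx
  rw [← hC] at hK
  have hI := hasDerivAt_cosIntegral (by linarith : 1 / 2 < v + 1 / 2 + 1) hx
  have h := (hdiv.mul hK).sub (((hasDerivAt_id x).mul
    ((hasDerivAt_two_mul_rpow hx v).mul hI)).const_mul (C * (2 * v + 1)))
  refine (h.congr_of_eventuallyEq hev).congr_deriv ?_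
  have hrec := cosIntegral_recurrence (by linarith : 1 / 2 < v + 1 / 2) hx
  rw [hK.deriv]
  have hBK : besselK v x = C * (2 * x) ^ v * cosIntegral (v + 1 / 2) x := rfl
  rw [show v + 1 / 2 + 1 + 1 = v + 1 / 2 + 2 by ring, hBK,
    show cosIntegral (v + 1 / 2) x = 4 * (v + 1 / 2) * (v + 1 / 2 + 1) * x ^ 2 *
      cosIntegral (v + 1 / 2 + 2) x - 2 * (v + 1 / 2) * (2 * (v + 1 / 2) + 1) *
      cosIntegral (v + 1 / 2 + 1) x by linarith]
  simp only [id, Pi.mul_apply]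
  field_simp
  ring

theorem stmt_4 (v : ℝ) (hv : 0 ≤ v) :
    (∀ x > (0:ℝ), DifferentiableAt ℝ (besselK v) x ∧
      DifferentiableAt ℝ (deriv (besselK v)) x) ∧
    ∀ x > (0:ℝ),
      x^2 * deriv (deriv (besselK v)) x + x * deriv (besselK v) x -
        (x^2 + v^2) * besselK v x = 0 := by
  rcases hv.eq_or_lt with rfl | hv
  · have h0 : ∀ x > (0 : ℝ), besselK 0 =ᶠ[𝓝 x] fun _ => 0 := fun x hx => by
      filter_upwards [Ioi_mem_nhds hx] with y hy using besselK_zero_eq_zero hy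
    have h1 : ∀ x > (0 : ℝ), deriv (besselK 0) =ᶠ[𝓝 x] fun _ => 0 := fun x hx => by
      simpa using (h0 x hx).deriv
    refine ⟨fun x hx => ⟨(h0 x hx).differentiableAt_iff.2 (by fun_prop),
      (h1 x hx).differentiableAt_iff.2 (by fun_prop)⟩, fun x hx => ?_⟩
    rw [(h1 x hx).deriv_eq, (h1 x hx).eq_of_nhds, (h0 x hx).eq_of_nhds]
    simp
  · refine ⟨fun x hx => ⟨(hasDerivAt_besselK hv hx).differentiableAt,
      (hasDerivAt_deriv_besselK hv hx).differentiableAt⟩, fun x hx => ?_⟩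
    rw [(hasDerivAt_deriv_besselK hv hx).deriv]
    field_simp
    ring
end

section
/- Let d ≥ 2 be a natural number. Suppose g̃ : (1,∞) × (0,∞) → ℝ is such that for each t > 0 the map w ↦ g̃(w,t) is twice continuously differentiable, and g̃ satisfies ∂g̃/∂t (w,t) = (1/2) ∂²g̃/∂w² (w,t) − ((d-1)/(2w)) ∂g̃/∂w (w,t) + ((d-1)/(2w²)) g̃(w,t) on (1,∞) × (0,∞). Assume in addition that for each t > 0 and r > 1: the functions w ↦ g̃(w,t), w ↦ ∂g̃/∂w(w,t), and w ↦ (1/w²) g̃(w,t) are integrable on (r,∞); lim_{w→∞} ∂g̃/∂w (w,t) = 0 and lim_{w→∞} g̃(w,t)/w = 0; and the function N(r,t) := ∫_r^∞ g̃(w,t) dw is differentiable in t with ∂N/∂t (r,t) = ∫_r^∞ ∂g̃/∂t (w,t) dw. Then N satisfies ∂N/∂t (r,t) = (1/2) ∂²N/∂r² (r,t) − ((d-1)/(2r)) ∂N/∂r (r,t) for all r > 1 and t > 0. -/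
open Real MeasureTheory Set Filter

/-- A pointwise bounded sequence of continuous functions on a nonempty open set is uniformly bounded
on some nondegenerate compact interval. -/
theorem exists_Icc_uniformly_bounded {q : ℕ → ℝ → ℝ} {V : Set ℝ} (hV : IsOpen V)
    (hne : V.Nonempty) (hq : ∀ n, ContinuousOn (q n) V)
    (hb : ∀ x ∈ V, ∃ C : ℝ, ∀ n, |q n x| ≤ C) :
    ∃ a b : ℝ, a < b ∧ Icc a b ⊆ V ∧ ∃ C : ℝ, ∀ n, ∀ x ∈ Icc a b, |q n x| ≤ C := by
  have : Nonempty V := hne.to_subtype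
  have : LocallyCompactSpace V := hV.locallyCompactSpace
  let A : ℕ → Set V := fun k => {x | ∀ n, |q n x| ≤ k}
  have hA : ∀ k, IsClosed (A k) := fun k => by
    simp only [A, ofPred_forall]
    exact isClosed_iInter fun n =>
      isClosed_le (continuousOn_iff_continuous_domRestrict.1 (hq n)).abs continuous_const
  have hU : ⋃ k, A k = univ := by
    refine eq_univ_of_forall fun x => ?_
    obtain ⟨C, hC⟩ := hb x x.2
    obtain ⟨k, hk⟩ := exists_nat_ge C
    exact mem_iUnion.2 ⟨k, fun n => (hC n).trans hk⟩
  obtain ⟨k, y, hy⟩ := nonempty_interior_of_iUnion_of_closed hA hU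
  have hO : IsOpen ((↑) '' interior (A k) : Set ℝ) :=
    hV.isOpenMap_subtype_val _ isOpen_interior
  obtain ⟨ε, hε, hball⟩ := Metric.isOpen_iff.1 hO y ⟨y, hy, rfl⟩
  have hsub : Icc (y : ℝ) (y + ε / 2) ⊆ ((↑) '' interior (A k) : Set ℝ) := fun x hx => by
    refine hball ?_
    rw [Metric.mem_ball, Real.dist_eq, abs_lt]
    constructor <;> linarith [hx.1, hx.2]
  refine ⟨y, y + ε / 2, by linarith, fun x hx => ?_, k, fun n x hx => ?_⟩
  · obtain ⟨z, -, rfl⟩ := hsub hx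
    exact z.2
  · obtain ⟨z, hz, rfl⟩ := hsub hx
    exact interior_subset hz n

/-- If continuous functions converge pointwise on an open set to a continuous function, and their
integrals over compact subintervals tend to zero, then the limit vanishes. -/
theorem eq_zero_of_tendsto_of_tendsto_integral_zero {q : ℕ → ℝ → ℝ} {f : ℝ → ℝ} {V : Set ℝ}
    (hV : IsOpen V) (hq : ∀ n, ContinuousOn (q n) V) (hf : ContinuousOn f V)
    (hlim : ∀ x ∈ V, f x ≠ 0 → Tendsto (fun n => q n x) atTop (nhds (f x)))
    (hint : ∀ a b, a < b → Icc a b ⊆ V →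
      Tendsto (fun n => ∫ x in a..b, q n x) atTop (nhds 0)) :
    ∀ x ∈ V, f x = 0 := by
  intro x hx
  by_contra hfx
  let W : Set ℝ := V ∩ (fun w => f x * f w) ⁻¹' Ioi 0
  have hWV : W ⊆ V := inter_subset_left
  have hW : IsOpen W := (continuousOn_const.mul hf).isOpen_inter_preimage hV isOpen_Ioi
  have hxW : x ∈ W := ⟨hx, mul_self_pos.2 hfx⟩
  have hWlim : ∀ w ∈ W, Tendsto (fun n => q n w) atTop (nhds (f w)) := fun w hw =>
    hlim w hw.1 (right_ne_zero_of_mul (ne_of_gt hw.2))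
  obtain ⟨a, b, hab, hI, C, hC⟩ := exists_Icc_uniformly_bounded hW ⟨x, hxW⟩
    (fun n => (hq n).mono hWV) fun w hw => by
      obtain ⟨C, hC⟩ := (hWlim w hw).abs.bddAbove_range
      exact ⟨C, fun n => hC ⟨n, rfl⟩⟩
  have hIV := hI.trans hWV
  have hIoc : uIoc a b ⊆ Icc a b := by rw [uIoc_of_le hab.le]; exact Ioc_subset_Icc_self
  have hconv : Tendsto (fun n => ∫ w in a..b, q n w) atTop (nhds (∫ w in a..b, f w)) := by
    refine intervalIntegral.tendsto_integral_filter_of_dominated_convergence (fun _ => C)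
      (.of_forall fun n => ?_) (.of_forall fun n => .of_forall fun w hw => ?_)
      intervalIntegrable_const (.of_forall fun w hw => hWlim w (hI (hIoc hw)))
    · exact ((hq n).mono (hIoc.trans hIV)).aestronglyMeasurable measurableSet_uIoc
    · exact hC n w (hIoc hw)
  have hzero : ∫ w in a..b, f w = 0 := tendsto_nhds_unique hconv (hint a b hab hIV)
  have hpos : 0 < ∫ w in a..b, f x * f w :=
    intervalIntegral.intervalIntegral_pos_of_pos_on
      ((continuousOn_const.mul (hf.mono hIV)).intervalIntegrable_of_Icc hab.le)
      (fun w hw => (hI (Ioo_subset_Icc_self hw)).2) hab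
  rw [intervalIntegral.integral_const_mul, hzero, mul_zero] at hpos
  exact hpos.false

/-- Differentiation under a tail integral: if `r ↦ ∫ w in Ioi r, g w t` can be differentiated in `t`
through the integral, and the `t`-derivative of `g` is the `w`-derivative of a function `F` vanishing
at infinity, then the `t`-derivative of the integral is `-F r`, even if integrability of the
`t`-derivative of `g` is not known. -/
theorem integral_Ioi_deriv_eq_neg {g N : ℝ → ℝ → ℝ} {F : ℝ → ℝ} {c t : ℝ} (ht : 0 < t)
    (hcont : ∀ t > (0:ℝ), ContinuousOn (fun w => g w t) (Ioi c))
    (hint : ∀ t > (0:ℝ), ∀ r > c, IntegrableOn (fun w => g w t) (Ioi r))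
    (hN : ∀ r t, N r t = ∫ w in Ioi r, g w t)
    (hNt : ∀ r > c, HasDerivAt (fun t' => N r t')
      (∫ w in Ioi r, deriv (fun t' => g w t') t) t)
    (hF : ∀ w > c, HasDerivAt F (deriv (fun t' => g w t') t) w)
    (hfc : ContinuousOn (fun w => deriv (fun t' => g w t') t) (Ioi c))
    (hF0 : Tendsto F atTop (nhds 0)) {r : ℝ} (hr : c < r) :
    ∫ w in Ioi r, deriv (fun t' => g w t') t = -F r := by
  set f : ℝ → ℝ := fun w => deriv (fun t' => g w t') t with hf
  suffices hfi : IntegrableOn f (Ioi r) by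
    rw [integral_Ioi_of_hasDerivAt_of_tendsto' (fun w hw => hF w (hr.trans_le hw)) hfi hF0,
      zero_sub]
  by_contra hbad
  have hbad' : ∀ s > c, ∫ w in Ioi s, f w = 0 := fun s hs => by
    refine integral_undef fun h => hbad ?_
    have h1 : IntegrableOn f (Icc r s) :=
      (hfc.mono fun w hw => hr.trans_le hw.1).integrableOn_Icc
    refine (h1.union h).mono_set fun w hw => ?_
    rcases le_or_gt w s with h | h
    · exact .inl ⟨le_of_lt hw, h⟩
    · exact .inr h
  let u : ℕ → ℝ := fun n => t + 1 / ((n : ℝ) + 1)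
  have hu0 : ∀ n, 0 < u n := fun n => by positivity
  have hu : Tendsto u atTop (nhdsWithin t {t}ᶜ) := by
    refine tendsto_nhdsWithin_iff.2 ⟨?_, .of_forall fun n => ?_⟩
    · simpa [u] using tendsto_one_div_add_atTop_nhds_zero_nat.const_add t
    · have : (0:ℝ) < 1 / ((n : ℝ) + 1) := by positivity
      exact ne_of_gt (by simp only [u]; linarith)
  have hfz : ∀ w ∈ Ioi c, f w = 0 := by
    refine eq_zero_of_tendsto_of_tendsto_integral_zero
      (q := fun n w => slope (fun t' => g w t') t (u n)) isOpen_Ioi (fun n => ?_) hfc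
      (fun w hw hfw => ?_) (fun a b hab hI => ?_)
    · simp only [slope_def_field]
      exact ((hcont _ (hu0 n)).sub (hcont t ht)).div_const _
    · exact (hasDerivAt_iff_tendsto_slope.1
        (differentiableAt_of_deriv_ne_zero hfw).hasDerivAt).comp hu
    · have ha : c < a := hI ⟨le_rfl, hab.le⟩
      have hb : c < b := ha.trans hab
      have hslope : ∀ s > c, Tendsto (fun n => slope (fun t' => N s t') t (u n)) atTop
          (nhds 0) := fun s hs => by
        have := (hasDerivAt_iff_tendsto_slope.1 (hNt s hs)).comp hu
        rwa [hbad' s hs] at this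
      have hdiff : ∀ τ > 0, ∫ w in a..b, g w τ = N a τ - N b τ := fun τ hτ => by
        rw [hN, hN, intervalIntegral.integral_Ioi_sub_Ioi (hint τ hτ a ha) hab.le,
          intervalIntegral.integral_of_le hab.le]
      have hii : ∀ τ > 0, IntervalIntegrable (fun w => g w τ) volume a b := fun τ hτ =>
        ((hcont τ hτ).mono hI).intervalIntegrable_of_Icc hab.le
      have h := (hslope a ha).sub (hslope b hb)
      rw [sub_zero] at h
      refine h.congr fun n => ?_
      simp only [slope_def_field]
      rw [intervalIntegral.integral_div, intervalIntegral.integral_sub (hii _ (hu0 n)) (hii t ht),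
        hdiff _ (hu0 n), hdiff t ht]
      ring
  exact hbad ((integrableOn_congr_fun (fun w hw => hfz w (hr.trans hw)) measurableSet_Ioi).2
    integrableOn_zero)

/-- The tail integral of a continuous integrable function has derivative `-G r`. -/
theorem hasDerivAt_integral_Ioi {G : ℝ → ℝ} {c r : ℝ} (hr : c < r)
    (hG : ContinuousOn G (Ioi c)) (hint : ∀ s > c, IntegrableOn G (Ioi s)) :
    HasDerivAt (fun s => ∫ w in Ioi s, G w) (-G r) r := by
  obtain ⟨a, hca, har⟩ := exists_between hr
  have hat : ContinuousAt G r := hG.continuousAt (Ioi_mem_nhds hr)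
  have h1 : HasDerivAt (fun s => ∫ w in a..s, G w) (G r) r :=
    intervalIntegral.integral_hasDerivAt_right
      ((hG.mono fun w hw => hca.trans_le hw.1).intervalIntegrable_of_Icc har.le)
      (hG.stronglyMeasurableAtFilter isOpen_Ioi r hr) hat
  refine (h1.const_sub (∫ w in Ioi a, G w)).congr_of_eventuallyEq ?_
  filter_upwards [Ioi_mem_nhds har] with s hs
  rw [← intervalIntegral.integral_Ioi_sub_Ioi' (hint a hca) (hint s (hca.trans hs))]
  ring

theorem stmt_5 (d : ℕ) (hd : 2 ≤ d)
    (g : ℝ → ℝ → ℝ)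
    (hC2 : ∀ t > (0:ℝ), ContDiffOn ℝ 2 (fun w => g w t) (Set.Ioi 1))
    (hpde : ∀ w > (1:ℝ), ∀ t > (0:ℝ),
      deriv (fun t' => g w t') t =
        (1/2) * deriv (deriv (fun w' => g w' t)) w -
          (((d : ℝ) - 1)/(2*w)) * deriv (fun w' => g w' t) w +
          (((d : ℝ) - 1)/(2*w^2)) * g w t)
    (hint : ∀ t > (0:ℝ), ∀ r > (1:ℝ),
      IntegrableOn (fun w => g w t) (Set.Ioi r) ∧
      IntegrableOn (fun w => deriv (fun w' => g w' t) w) (Set.Ioi r) ∧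
      IntegrableOn (fun w => (1/w^2) * g w t) (Set.Ioi r))
    (hlim : ∀ t > (0:ℝ),
      Tendsto (fun w => deriv (fun w' => g w' t) w) atTop (nhds 0) ∧
      Tendsto (fun w => g w t / w) atTop (nhds 0))
    (N : ℝ → ℝ → ℝ)
    (hN : ∀ r t, N r t = ∫ w in Set.Ioi r, g w t)
    (hNt : ∀ r > (1:ℝ), ∀ t > (0:ℝ),
      HasDerivAt (fun t' => N r t')
        (∫ w in Set.Ioi r, deriv (fun t' => g w t') t) t) :
    ∀ r > (1:ℝ), ∀ t > (0:ℝ),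
      deriv (fun t' => N r t') t =
        (1/2) * deriv (deriv (fun r' => N r' t)) r -
          (((d : ℝ) - 1)/(2*r)) * deriv (fun r' => N r' t) r := by
  intro r hr t ht
  have hO : IsOpen (Ioi (1:ℝ)) := isOpen_Ioi
  have hcont : ∀ t > (0:ℝ), ContinuousOn (fun w => g w t) (Ioi 1) := fun t ht =>
    (hC2 t ht).continuousOn
  set G : ℝ → ℝ := fun w => g w t with hGdef
  have hG1 : ContDiffOn ℝ 1 (deriv G) (Ioi 1) :=
    ((contDiffOn_succ_iff_deriv_of_isOpen (n := 1) hO).1 (hC2 t ht)).2.2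
  have hG2c : ContinuousOn (deriv (deriv G)) (Ioi 1) :=
    hG1.continuousOn_deriv_of_isOpen hO le_rfl
  have hdG : ∀ w > (1:ℝ), HasDerivAt G (deriv G w) w := fun w hw =>
    (((hC2 t ht).differentiableOn two_ne_zero).differentiableAt (Ioi_mem_nhds hw)).hasDerivAt
  have hddG : ∀ w > (1:ℝ), HasDerivAt (deriv G) (deriv (deriv G) w) w := fun w hw =>
    ((hG1.differentiableOn one_ne_zero).differentiableAt (Ioi_mem_nhds hw)).hasDerivAt
  have hF : ∀ w > (1:ℝ), HasDerivAt
      (fun w => (1/2) * deriv G w - (((d : ℝ) - 1)/2) * (G w / w))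
      (deriv (fun t' => g w t') t) w := fun w hw => by
    have hw0 : w ≠ 0 := by linarith
    rw [hpde w hw t ht]
    refine (((hddG w hw).const_mul (1/2)).sub
      (((hdG w hw).div (hasDerivAt_id w) hw0).const_mul (((d : ℝ) - 1)/2))).congr_deriv ?_
    simp only [id, hGdef]
    field_simp
    ring
  have hfc : ContinuousOn (fun w => deriv (fun t' => g w t') t) (Ioi 1) := by
    refine ContinuousOn.congr (f := fun w => (1/2) * deriv (deriv G) w -
      (((d : ℝ) - 1)/(2*w)) * deriv G w + (((d : ℝ) - 1)/(2*w^2)) * G w) ?_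
      fun w hw => hpde w hw t ht
    have hne : ∀ w ∈ Ioi (1:ℝ), w ≠ 0 := fun w hw => (zero_lt_one.trans hw).ne'
    have hc1 := hG1.continuousOn
    have hc0 := hcont t ht
    refine ((continuousOn_const.mul hG2c).sub (.mul (.div continuousOn_const (by fun_prop) ?_)
      hc1)).add (.mul (.div continuousOn_const (by fun_prop) ?_) hc0)
    · exact fun w hw => mul_ne_zero two_ne_zero (hne w hw)
    · exact fun w hw => mul_ne_zero two_ne_zero (pow_ne_zero 2 (hne w hw))
  have hF0 : Tendsto (fun w => (1/2) * deriv G w - (((d : ℝ) - 1)/2) * (G w / w)) atTop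
      (nhds 0) := by
    have h := ((hlim t ht).1.const_mul (1/2)).sub
      ((hlim t ht).2.const_mul (((d : ℝ) - 1)/2))
    rwa [mul_zero, mul_zero, sub_zero] at h
  have hNr : ∀ s > (1:ℝ), HasDerivAt (fun r' => N r' t) (-G s) s := fun s hs => by
    simp only [hN]
    exact hasDerivAt_integral_Ioi hs (hcont t ht) fun s hs => (hint t ht s hs).1
  have hNrr : deriv (deriv fun r' => N r' t) r = -deriv G r := by
    have h : deriv (fun r' => N r' t) =ᶠ[nhds r] fun s => -G s := by
      filter_upwards [Ioi_mem_nhds hr] with s hs using (hNr s hs).deriv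
    rw [h.deriv_eq]
    exact (hdG r hr).neg.deriv
  rw [(hNt r hr t ht).deriv, hNrr, (hNr r hr).deriv,
    integral_Ioi_deriv_eq_neg ht hcont (fun t ht r hr => (hint t ht r hr).1) hN
      (fun r hr => hNt r hr t ht) hF hfc hF0 hr]
  have hr0 : r ≠ 0 := by linarith
  field_simp
  ring
end

section
/- For every natural number k and every τ > 0, lim_{r→∞} r^k · ∫₀^τ (r-1) · e^{-(r-1)²/(2t)} · t^{-3/2} dt = 0, where the limit is taken as r → ∞ along r > 1. -/
open Real MeasureTheory Set Filter

theorem exp_neg_div_le_factorial_mul_div_pow (m : ℕ) {a b : ℝ} (ha : 0 < a) (hb : 0 < b) :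
    Real.exp (-a / b) ≤ m.factorial * b ^ m / a ^ m := by
  have h := Real.pow_div_factorial_le_exp (a / b) (by positivity) m
  rw [neg_div, Real.exp_neg, inv_le_comm₀ (Real.exp_pos _) (by positivity)]
  refine le_trans (le_of_eq ?_) h
  rw [div_pow]
  field_simp

theorem mul_exp_neg_sq_div_mul_rpow_le (k : ℕ) {τ s t : ℝ} (hs : 1 ≤ s) (ht : 0 < t)
    (htτ : t ≤ τ) :
    s * Real.exp (-s ^ 2 / (2 * t)) * t ^ (-(3 : ℝ) / 2) ≤
      (k + 2).factorial * 2 ^ (k + 2) * τ ^ k * τ ^ ((1 : ℝ) / 2) / s ^ (k + 1) := by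
  have hs0 : 0 < s := by linarith
  have hτ : 0 < τ := by linarith
  have hrpow : t ^ 2 * t ^ (-(3 : ℝ) / 2) = t ^ ((1 : ℝ) / 2) := by
    rw [← Real.rpow_natCast, ← Real.rpow_add ht]
    norm_num
  calc s * Real.exp (-s ^ 2 / (2 * t)) * t ^ (-(3 : ℝ) / 2)
      ≤ s * ((k + 2).factorial * (2 * t) ^ (k + 2) / (s ^ 2) ^ (k + 2)) *
          t ^ (-(3 : ℝ) / 2) := by
        gcongr
        exact exp_neg_div_le_factorial_mul_div_pow _ (by positivity) (by positivity)
    _ = (k + 2).factorial * 2 ^ (k + 2) * t ^ k * (t ^ 2 * t ^ (-(3 : ℝ) / 2)) /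
          s ^ (2 * k + 3) := by
        field_simp
        ring
    _ = (k + 2).factorial * 2 ^ (k + 2) * t ^ k * t ^ ((1 : ℝ) / 2) / s ^ (2 * k + 3) := by
        rw [hrpow]
    _ ≤ (k + 2).factorial * 2 ^ (k + 2) * τ ^ k * τ ^ ((1 : ℝ) / 2) / s ^ (k + 1) := by
        gcongr <;> omega

theorem stmt_8 (k : ℕ) (τ : ℝ) (hτ : 0 < τ) :
    Tendsto
      (fun r : ℝ =>
        r ^ k * ∫ t in Set.Ioo (0:ℝ) τ, (r - 1) * Real.exp (-(r - 1)^2/(2*t)) * t ^ (-(3:ℝ)/2))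
      (atTop ⊓ Filter.principal (Set.Ioi 1)) (nhds 0) := by
  refine Tendsto.mono_left ?_ inf_le_left
  set K : ℝ := (k + 2).factorial * 2 ^ (k + 2) * τ ^ k * τ ^ ((1 : ℝ) / 2)
  have hlim : Tendsto (fun r : ℝ => 2 ^ k * K * τ / (r - 1)) atTop (nhds 0) :=
    (tendsto_atTop_add_const_right _ (-1) tendsto_id).const_div_atTop _
  refine squeeze_zero_norm' ?_ hlim
  filter_upwards [eventually_ge_atTop 2] with r hr
  have hs : 1 ≤ r - 1 := by linarith
  have hs0 : 0 < r - 1 := by linarith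
  have hint : ‖∫ t in Set.Ioo (0:ℝ) τ,
      (r - 1) * Real.exp (-(r - 1)^2/(2*t)) * t ^ (-(3:ℝ)/2)‖ ≤ K / (r - 1) ^ (k + 1) * τ := by
    have h := norm_setIntegral_le_of_norm_le_const (μ := volume) (s := Set.Ioo (0:ℝ) τ)
      (f := fun t => (r - 1) * Real.exp (-(r - 1)^2/(2*t)) * t ^ (-(3:ℝ)/2))
      (C := K / (r - 1) ^ (k + 1)) (by simp) fun t ht => by
        have ht0 : 0 < t := ht.1
        rw [Real.norm_of_nonneg (by positivity)]
        exact mul_exp_neg_sq_div_mul_rpow_le k hs ht0 ht.2.le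
    simpa [Real.volume_real_Ioo_of_le hτ.le] using h
  have hr0 : 0 ≤ r := by linarith
  calc ‖r ^ k * ∫ t in Set.Ioo (0:ℝ) τ,
        (r - 1) * Real.exp (-(r - 1)^2/(2*t)) * t ^ (-(3:ℝ)/2)‖
      ≤ (2 * (r - 1)) ^ k * (K / (r - 1) ^ (k + 1) * τ) := by
        rw [norm_mul, norm_pow, Real.norm_of_nonneg hr0]
        gcongr
        linarith
    _ = 2 ^ k * K * τ / (r - 1) := by
        rw [mul_pow, pow_succ]
        field_simp
end

section
/- Let v ≥ 0 and let z ∈ ℂ with Re z > 0. Then for every natural number k, lim_{r→∞} r^k · K_v(r·z) = 0, where the limit is taken as the real number r → ∞ and K_v is given by the integral representation K_v(w) = π^{-1/2} Γ(v+1/2) (2w)^v ∫₀^∞ cos(t) · (t²+w²)^{-(v+1/2)} dt. -/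
open Real MeasureTheory Set Filter Complex

/-- The modified Bessel function of the second kind for complex argument `w`
with `Re w > 0`, defined via the integral representation (principal branch powers). -/
noncomputable def besselKC (v : ℝ) (w : ℂ) : ℂ :=
  (Real.pi : ℂ) ^ (-(1 : ℂ)/2) * Complex.Gamma ((v : ℂ) + 1/2) * (2*w) ^ (v : ℂ) *
    ∫ t in Set.Ioi (0:ℝ), (Real.cos t : ℂ) * ((t : ℂ)^2 + w^2) ^ (-((v : ℂ) + 1/2))

theorem sq_add_sq_mem_slitPlane {z : ℂ} (hz : 0 < z.re) (s : ℝ) :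
    (s : ℂ) ^ 2 + z ^ 2 ∈ slitPlane := by
  rw [mem_slitPlane_iff]
  have him : ((s : ℂ) ^ 2 + z ^ 2).im = 2 * z.re * z.im := by
    simp [pow_two]; ring
  have hre : ((s : ℂ) ^ 2 + z ^ 2).re = s ^ 2 + z.re ^ 2 - z.im ^ 2 := by
    simp [pow_two]; ring
  rw [him, hre]
  by_cases h : z.im = 0
  · left
    rw [h, zero_pow two_ne_zero, sub_zero]
    positivity
  · right
    exact mul_ne_zero (by positivity) h

theorem exists_le_norm_sq_add_sq {z : ℂ} (hz : 0 < z.re) :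
    ∃ c > 0, ∀ s : ℝ, c * (1 + s ^ 2) ≤ ‖(s : ℂ) ^ 2 + z ^ 2‖ := by
  obtain ⟨x, y⟩ := z
  change 0 < x at hz
  have hD : 0 < 2 + (1 + 2 * y ^ 2) / x ^ 2 := by positivity
  set D := 2 + (1 + 2 * y ^ 2) / x ^ 2 with hDdef
  have hDx : D * x ^ 2 = 2 * x ^ 2 + (1 + 2 * y ^ 2) := by
    rw [hDdef]; field_simp
  have hD2 : 2 ≤ D := by rw [hDdef]; linarith [show 0 ≤ (1 + 2 * y ^ 2) / x ^ 2 by positivity]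
  have key (t u : ℝ) (hu : u ^ 2 = y ^ 2) : 1 + t ^ 2 ≤ D * ((t + u) ^ 2 + x ^ 2) := by
    nlinarith [mul_le_mul_of_nonneg_right hD2 (sq_nonneg (t + u)), sq_nonneg (t + 2 * u),
      sq_nonneg x]
  refine ⟨D⁻¹, by positivity, fun s => ?_⟩
  refine abs_le_of_sq_le_sq' ?_ (norm_nonneg _) |>.2
  have hn : ‖(s : ℂ) ^ 2 + (⟨x, y⟩ : ℂ) ^ 2‖ ^ 2 =
      ((s + y) ^ 2 + x ^ 2) * ((s + -y) ^ 2 + x ^ 2) := by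
    rw [← Complex.normSq_eq_norm_sq, Complex.normSq_apply]
    simp [pow_two]
    ring
  rw [hn]
  have h := mul_le_mul (key s y rfl) (key s (-y) (by ring)) (by positivity) (by positivity)
  rw [mul_pow, inv_pow, inv_mul_le_iff₀ (by positivity)]
  calc _ = (1 + s ^ 2) * (1 + s ^ 2) := by ring
    _ ≤ _ := h
    _ = _ := by ring

theorem exists_norm_eval_ofReal_le (P : Polynomial ℂ) {n : ℕ} (hP : P.natDegree ≤ n) :
    ∃ C, 0 ≤ C ∧ ∀ s : ℝ, ‖P.eval (s : ℂ)‖ ≤ C * (1 + s ^ 2) ^ ((n : ℝ) / 2) := by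
  refine ⟨∑ i ∈ Finset.range (P.natDegree + 1), ‖P.coeff i‖, by positivity, fun s => ?_⟩
  rw [Polynomial.eval_eq_sum_range, Finset.sum_mul]
  refine (norm_sum_le _ _).trans (Finset.sum_le_sum fun i hi => ?_)
  rw [norm_mul, norm_pow, Complex.norm_real, Real.norm_eq_abs]
  gcongr
  have hi' : i ≤ n := by
    have := Finset.mem_range.1 hi
    omega
  calc |s| ^ i = (s ^ 2) ^ ((i : ℝ) / 2) := by
        rw [← sq_abs, ← Real.rpow_natCast, ← Real.rpow_natCast, ← Real.rpow_mul (abs_nonneg s)]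
        congr 1
        push_cast
        ring
    _ ≤ (1 + s ^ 2) ^ ((i : ℝ) / 2) := by
        gcongr
        linarith
    _ ≤ (1 + s ^ 2) ^ ((n : ℝ) / 2) := by
        gcongr
        nlinarith [sq_nonneg s]

theorem hasDerivAt_eval_mul_cpow {z : ℂ} (hz : 0 < z.re) (P : Polynomial ℂ) (c : ℂ) (s : ℝ) :
    HasDerivAt (fun s : ℝ => P.eval (s : ℂ) * ((s : ℂ) ^ 2 + z ^ 2) ^ (c + 1))
      ((P.derivative * (Polynomial.X ^ 2 + Polynomial.C (z ^ 2)) +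
        Polynomial.C (2 * (c + 1)) * (Polynomial.X * P)).eval (s : ℂ) *
          ((s : ℂ) ^ 2 + z ^ 2) ^ c) s := by
  have hq := sq_add_sq_mem_slitPlane hz s
  have h1 : HasDerivAt (fun u : ℂ => u ^ 2 + z ^ 2) (2 * (s : ℂ)) (s : ℂ) := by
    simpa using (hasDerivAt_pow 2 (s : ℂ)).add_const (z ^ 2)
  have h2 := ((P.hasDerivAt (s : ℂ)).mul (h1.cpow_const (c := c + 1) hq)).comp_ofReal
  refine h2.congr_deriv ?_
  rw [Complex.cpow_add _ _ (slitPlane_ne_zero hq)]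
  simp
  ring

theorem integrable_eval_mul_cpow {z : ℂ} (hz : 0 < z.re) (P : Polynomial ℂ) {n : ℕ}
    (hP : P.natDegree ≤ n) {b : ℝ} (hb : n + 1 < 2 * b) :
    Integrable (fun s : ℝ => P.eval (s : ℂ) * ((s : ℂ) ^ 2 + z ^ 2) ^ (-(b : ℂ))) := by
  obtain ⟨c, hc, hq⟩ := exists_le_norm_sq_add_sq hz
  obtain ⟨C, hC, hPC⟩ := exists_norm_eval_ofReal_le P hP
  have hint : Integrable fun s : ℝ => ((1 : ℝ) + ‖s‖ ^ 2) ^ (-(2 * b - n) / 2) :=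
    integrable_rpow_neg_one_add_norm_sq (by simp; linarith)
  refine (hint.const_mul (C * c ^ (-b))).mono' ?_ (.of_forall fun s => ?_)
  · refine Continuous.aestronglyMeasurable ?_
    refine continuous_iff_continuousAt.2 fun s => ?_
    have := hasDerivAt_eval_mul_cpow hz P (-(b : ℂ) - 1) s
    simpa using this.continuousAt
  · rw [norm_mul, ← Complex.ofReal_neg, norm_cpow_real, Real.norm_eq_abs, sq_abs]
    have h1 : ‖(s : ℂ) ^ 2 + z ^ 2‖ ^ (-b) ≤ (c * (1 + s ^ 2)) ^ (-b) :=
      Real.rpow_le_rpow_of_nonpos (by positivity) (hq s) (by linarith [n.cast_nonneg (α := ℝ)])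
    calc _ ≤ (C * (1 + s ^ 2) ^ ((n : ℝ) / 2)) * (c * (1 + s ^ 2)) ^ (-b) :=
          mul_le_mul (hPC s) h1 (by positivity) (by positivity)
      _ = C * c ^ (-b) * ((1 + s ^ 2) ^ ((n : ℝ) / 2) * (1 + s ^ 2) ^ (-b)) := by
          rw [Real.mul_rpow hc.le (by positivity)]
          ring
      _ = _ := by
          rw [← Real.rpow_add (by positivity)]
          congr 2
          ring

theorem exists_iteratedDeriv_cpow_eq {z : ℂ} (hz : 0 < z.re) (a : ℝ) (n : ℕ) :
    ∃ P : Polynomial ℂ, P.natDegree ≤ n ∧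
      iteratedDeriv n (fun s : ℝ => ((s : ℂ) ^ 2 + z ^ 2) ^ (-(a : ℂ))) =
        fun s : ℝ => P.eval (s : ℂ) * ((s : ℂ) ^ 2 + z ^ 2) ^ (-((a + n : ℝ) : ℂ)) := by
  induction n with
  | zero => exact ⟨1, by simp, by simp⟩
  | succ n ih =>
    obtain ⟨P, hP, h⟩ := ih
    have hc : -((a + n : ℝ) : ℂ) = -((a + (n + 1 : ℕ) : ℝ) : ℂ) + 1 := by
      push_cast
      ring
    refine ⟨P.derivative * (Polynomial.X ^ 2 + Polynomial.C (z ^ 2)) +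
      Polynomial.C (2 * (-((a + (n + 1 : ℕ) : ℝ) : ℂ) + 1)) * (Polynomial.X * P), ?_, ?_⟩
    rotate_left
    · rw [iteratedDeriv_succ, h]
      funext s
      rw [hc]
      exact (hasDerivAt_eval_mul_cpow hz P _ s).deriv
    · refine Polynomial.natDegree_add_le_of_degree_le ?_ ?_
      · by_cases h0 : P.natDegree = 0
        · simp [Polynomial.derivative_of_natDegree_zero h0]
        · refine Polynomial.natDegree_mul_le.trans ?_
          rw [Polynomial.natDegree_X_pow_add_C]
          have := Polynomial.natDegree_derivative_lt h0
          omega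
      · refine (Polynomial.natDegree_C_mul_le _ _).trans (Polynomial.natDegree_mul_le.trans ?_)
        rw [Polynomial.natDegree_X]
        omega

theorem integrable_iteratedDeriv_cpow {z : ℂ} (hz : 0 < z.re) {a : ℝ} (ha : 1 < 2 * a) (n : ℕ) :
    Integrable (iteratedDeriv n (fun s : ℝ => ((s : ℂ) ^ 2 + z ^ 2) ^ (-(a : ℂ)))) := by
  obtain ⟨P, hP, h⟩ := exists_iteratedDeriv_cpow_eq hz a n
  rw [h]
  exact integrable_eval_mul_cpow hz P hP (by linarith [n.cast_nonneg (α := ℝ)])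

theorem contDiff_sq_add_sq_cpow {z : ℂ} (hz : 0 < z.re) (a : ℝ) (N : ℕ∞) :
    ContDiff ℝ N (fun s : ℝ => ((s : ℂ) ^ 2 + z ^ 2) ^ (-(a : ℂ))) := by
  refine contDiff_of_differentiable_iteratedDeriv fun n _ s => ?_
  obtain ⟨P, hP, h⟩ := exists_iteratedDeriv_cpow_eq hz a n
  rw [h]
  have := hasDerivAt_eval_mul_cpow hz P (-((a + n : ℝ) : ℂ) - 1) s
  rw [sub_add_cancel] at this
  exact this.differentiableAt

open FourierTransform in
theorem exists_pow_mul_norm_fourier_le {z : ℂ} (hz : 0 < z.re) {a : ℝ} (ha : 1 < 2 * a) (n : ℕ) :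
    ∃ M, ∀ x : ℝ, (2 * π * |x|) ^ n *
      ‖𝓕 (fun s : ℝ => ((s : ℂ) ^ 2 + z ^ 2) ^ (-(a : ℂ))) x‖ ≤ M := by
  set f := fun s : ℝ => ((s : ℂ) ^ 2 + z ^ 2) ^ (-(a : ℂ)) with hf
  refine ⟨∫ s, ‖iteratedDeriv n f s‖, fun x => ?_⟩
  have h := congrFun (Real.fourier_iteratedDeriv (N := ⊤) (n := n) (contDiff_sq_add_sq_cpow hz a ⊤)
    (fun m _ => integrable_iteratedDeriv_cpow hz ha m) le_top) x
  calc _ = ‖𝓕 (iteratedDeriv n f) x‖ := by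
        rw [h]
        simp [abs_of_pos Real.pi_pos, hf]
    _ ≤ _ := VectorFourier.norm_fourierIntegral_le_integral_norm _ _ _ _ _

open FourierTransform in
theorem integral_Ioi_cos_mul_eq_fourier {f : ℝ → ℂ} (hf : Integrable f)
    (heven : ∀ s, f (-s) = f s) (r : ℝ) :
    ∫ s in Ioi (0 : ℝ), (Real.cos (r * s) : ℂ) * f s =
      (𝓕 f (r / (2 * π)) + 𝓕 f (-(r / (2 * π)))) / 4 := by
  have hexp (w : ℝ) : Integrable fun s : ℝ => Complex.exp ((w * s : ℝ) * I) * f s := by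
    refine hf.bdd_mul (c := 1) (by fun_prop) (.of_forall fun s => ?_)
    rw [Complex.norm_exp_ofReal_mul_I]
  have hcos (s : ℝ) : (Real.cos (r * s) : ℂ) * f s =
      (Complex.exp ((-r * s : ℝ) * I) * f s + Complex.exp ((r * s : ℝ) * I) * f s) / 2 := by
    rw [Complex.ofReal_cos, Complex.cos]
    push_cast
    ring_nf
  have hint : Integrable fun s : ℝ => (Real.cos (r * s) : ℂ) * f s := by
    simp_rw [hcos]
    exact ((hexp _).add (hexp _)).div_const _
  have hF (w : ℝ) : 𝓕 f w = ∫ s : ℝ, Complex.exp ((-(2 * π * w) * s : ℝ) * I) * f s := by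
    rw [Real.fourier_real_eq_integral_exp_smul]
    congr 1
    funext s
    rw [smul_eq_mul]
    ring_nf
  have hfull : ∫ s : ℝ, (Real.cos (r * s) : ℂ) * f s =
      (𝓕 f (r / (2 * π)) + 𝓕 f (-(r / (2 * π)))) / 2 := by
    simp_rw [hcos]
    rw [integral_div, integral_add (hexp _) (hexp _), hF, hF]
    have h1 : 2 * π * (r / (2 * π)) = r := by field_simp
    rw [mul_neg, neg_neg, h1]
  have hhalf : ∫ s in Iic (0 : ℝ), (Real.cos (r * s) : ℂ) * f s =
      ∫ s in Ioi (0 : ℝ), (Real.cos (r * s) : ℂ) * f s := by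
    have := integral_comp_neg_Iic 0 fun s : ℝ => (Real.cos (r * s) : ℂ) * f s
    simpa [heven] using this
  rw [← intervalIntegral.integral_Iic_add_Ioi (b := (0 : ℝ)) hint.integrableOn
    hint.integrableOn, hhalf] at hfull
  linear_combination hfull / 2

theorem exists_pow_mul_norm_integral_cos_mul_cpow_le {z : ℂ} (hz : 0 < z.re) {a : ℝ}
    (ha : 1 < 2 * a) (n : ℕ) :
    ∃ M, ∀ r : ℝ, 0 ≤ r → r ^ n * ‖∫ s in Ioi (0 : ℝ), (Real.cos (r * s) : ℂ) *
      ((s : ℂ) ^ 2 + z ^ 2) ^ (-(a : ℂ))‖ ≤ M := by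
  obtain ⟨M, hM⟩ := exists_pow_mul_norm_fourier_le hz ha n
  have hint := integrable_iteratedDeriv_cpow hz ha 0
  rw [iteratedDeriv_zero] at hint
  refine ⟨M, fun r hr => ?_⟩
  rw [integral_Ioi_cos_mul_eq_fourier hint (by simp) r]
  have h1 := hM (r / (2 * π))
  have h2 := hM (-(r / (2 * π)))
  have h3 : 2 * π * |r / (2 * π)| = r := by
    rw [abs_of_nonneg (by positivity)]
    field_simp
  rw [abs_neg, h3] at h2
  rw [h3] at h1
  rw [norm_div, Complex.norm_ofNat, mul_div_assoc']
  have h4 := mul_le_mul_of_nonneg_left (norm_add_le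
    (FourierTransform.fourier (fun s : ℝ => ((s : ℂ) ^ 2 + z ^ 2) ^ (-(a : ℂ))) (r / (2 * π)))
    (FourierTransform.fourier (fun s : ℝ => ((s : ℂ) ^ 2 + z ^ 2) ^ (-(a : ℂ))) (-(r / (2 * π)))))
    (pow_nonneg hr n)
  have h5 : 0 ≤ M := le_trans (by positivity) h1
  rw [div_le_iff₀ (by norm_num)]
  linarith

theorem integral_cos_mul_cpow_comp_mul {z : ℂ} (hz : 0 < z.re) (a : ℝ) {r : ℝ} (hr : 0 < r) :
    ∫ t in Ioi (0 : ℝ), (Real.cos t : ℂ) * ((t : ℂ) ^ 2 + (r * z) ^ 2) ^ (-(a : ℂ)) =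
      r * ((r ^ 2 : ℝ) : ℂ) ^ (-(a : ℂ)) * ∫ s in Ioi (0 : ℝ), (Real.cos (r * s) : ℂ) *
        ((s : ℂ) ^ 2 + z ^ 2) ^ (-(a : ℂ)) := by
  have h := integral_comp_mul_left_Ioi
    (fun t : ℝ => (Real.cos t : ℂ) * ((t : ℂ) ^ 2 + (r * z) ^ 2) ^ (-(a : ℂ))) 0 hr
  rw [mul_zero] at h
  have hr' : (r : ℂ) ≠ 0 := by exact_mod_cast hr.ne'
  have h' := congrArg (fun u : ℂ => (r : ℂ) * u) h
  simp only [real_smul, ofReal_inv, mul_inv_cancel_left₀ hr'] at h'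
  rw [← h', mul_assoc, ← integral_const_mul (((r ^ 2 : ℝ) : ℂ) ^ (-(a : ℂ)))]
  congr 2
  funext s
  have hq := slitPlane_ne_zero (sq_add_sq_mem_slitPlane hz s)
  have hr2 : 0 < r ^ 2 := by positivity
  have hr2' : ((r ^ 2 : ℝ) : ℂ) ≠ 0 := by exact_mod_cast hr2.ne'
  have : ((r * s : ℝ) : ℂ) ^ 2 + (r * z) ^ 2 = ((r ^ 2 : ℝ) : ℂ) * ((s : ℂ) ^ 2 + z ^ 2) := by
    push_cast
    ring
  rw [this, cpow_def_of_ne_zero (mul_ne_zero hr2' hq), log_ofReal_mul hr2 hq, add_mul,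
    Complex.exp_add, cpow_def_of_ne_zero hr2', cpow_def_of_ne_zero hq, ofReal_log hr2.le]
  ring

theorem not_integrableOn_cos_mul_inv : ¬ IntegrableOn (fun t : ℝ => Real.cos t * t⁻¹) (Ioi 1) := by
  intro h
  have hπ := Real.pi_pos
  have hshift : IntegrableOn (fun t : ℝ => Real.cos (t + π / 2) * (t + π / 2)⁻¹) (Ioi 1) := by
    have h2 : IntegrableOn (fun t : ℝ => Real.cos t * t⁻¹) (Ioi (1 + π / 2)) :=
      h.mono_set (Ioi_subset_Ioi (by linarith))
    have := (measurePreserving_add_right volume (π / 2)).integrableOn_comp_preimage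
      (measurableEmbedding_addRight (π / 2)) (f := fun t : ℝ => Real.cos t * t⁻¹)
      (s := Ioi (1 + π / 2))
    rw [Set.preimage_add_const_Ioi, add_sub_cancel_right] at this
    exact this.2 h2
  refine not_integrableOn_Ioi_inv (a := (1 : ℝ)) ?_
  refine Integrable.mono' (h.norm.add (hshift.norm.const_mul 3))
    (by fun_prop) ?_
  refine (ae_restrict_iff' measurableSet_Ioi).2 (.of_forall fun t (ht : 1 < t) => ?_)
  have ht0 : 0 < t := by linarith
  have hs : 0 < t + π / 2 := by linarith
  have hinv : t⁻¹ ≤ 3 * (t + π / 2)⁻¹ := by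
    rw [← div_eq_mul_inv, le_div_iff₀ hs, inv_mul_le_iff₀ ht0]
    nlinarith [Real.pi_le_four]
  simp only [Pi.add_apply, norm_mul, Real.cos_add_pi_div_two, norm_neg, norm_inv,
    Real.norm_eq_abs, abs_of_pos ht0, abs_of_pos hs]
  have hcs : 1 ≤ |Real.cos t| + |Real.sin t| := by
    nlinarith [Real.sin_sq_add_cos_sq t, sq_abs (Real.sin t), sq_abs (Real.cos t),
      abs_nonneg (Real.sin t), abs_nonneg (Real.cos t)]
  calc t⁻¹ ≤ (|Real.cos t| + |Real.sin t|) * t⁻¹ := le_mul_of_one_le_left (by positivity) hcs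
    _ = |Real.cos t| * t⁻¹ + |Real.sin t| * t⁻¹ := add_mul _ _ _
    _ ≤ |Real.cos t| * t⁻¹ + |Real.sin t| * (3 * (t + π / 2)⁻¹) := by gcongr
    _ = _ := by ring

theorem not_integrableOn_cos_mul_cpow_neg_half {w : ℂ} (hw : 0 < w.re) :
    ¬ IntegrableOn (fun t : ℝ => (Real.cos t : ℂ) * ((t : ℂ) ^ 2 + w ^ 2) ^ (-(1 / 2 : ℂ)))
      (Ioi 0) := by
  intro h
  refine not_integrableOn_cos_mul_inv ?_
  have hB : 0 < 1 + ‖w‖ ^ 2 := by positivity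
  refine Integrable.mono' ((h.mono_set (Ioi_subset_Ioi zero_le_one)).norm.const_mul
    ((1 + ‖w‖ ^ 2) ^ (1 / 2 : ℝ))) (by fun_prop) ?_
  refine (ae_restrict_iff' measurableSet_Ioi).2 (.of_forall fun t (ht : 1 < t) => ?_)
  have ht0 : 0 < t := by linarith
  have hq : 0 < ‖(t : ℂ) ^ 2 + w ^ 2‖ :=
    norm_pos_iff.2 (slitPlane_ne_zero (sq_add_sq_mem_slitPlane hw t))
  have hle : ‖(t : ℂ) ^ 2 + w ^ 2‖ ≤ (1 + ‖w‖ ^ 2) * t ^ 2 := by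
    refine (norm_add_le _ _).trans ?_
    rw [norm_pow, norm_pow, Complex.norm_real, Real.norm_eq_abs, sq_abs]
    nlinarith [mul_nonneg (sq_nonneg ‖w‖) (show 0 ≤ t ^ 2 - 1 by nlinarith)]
  have hexp : (-(1 / 2 : ℂ)) = ((-(1 / 2) : ℝ) : ℂ) := by push_cast; rfl
  rw [norm_mul, norm_mul, hexp, norm_cpow_real, Complex.norm_real, norm_inv,
    Real.norm_of_nonneg ht0.le, mul_left_comm]
  gcongr
  calc t⁻¹ = (1 + ‖w‖ ^ 2) ^ (1 / 2 : ℝ) * ((1 + ‖w‖ ^ 2) * t ^ 2) ^ (-(1 / 2) : ℝ) := by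
        rw [Real.mul_rpow hB.le (by positivity), ← mul_assoc, ← Real.rpow_add hB,
          ← Real.rpow_natCast t 2, ← Real.rpow_mul ht0.le]
        norm_num [Real.rpow_neg_one]
    _ ≤ _ := by
        exact mul_le_mul_of_nonneg_left (Real.rpow_le_rpow_of_nonpos hq hle (by norm_num))
          (by positivity)

theorem besselKC_zero {w : ℂ} (hw : 0 < w.re) : besselKC 0 w = 0 := by
  rw [besselKC, integral_undef, mul_zero]
  simpa [IntegrableOn] using not_integrableOn_cos_mul_cpow_neg_half hw

theorem exists_norm_besselKC_le {v : ℝ} (hv : 0 < v) {z : ℂ} (hz : 0 < z.re) (n : ℕ) :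
    ∃ C, ∀ r : ℝ, 1 ≤ r → r ^ n * ‖besselKC v (r * z)‖ ≤ C := by
  obtain ⟨M, hM⟩ := exists_pow_mul_norm_integral_cos_mul_cpow_le hz (a := v + 1 / 2)
    (by linarith) n
  set A := ‖(π : ℂ) ^ (-(1 : ℂ) / 2) * Complex.Gamma ((v : ℂ) + 1 / 2)‖ * ‖2 * z‖ ^ v with hA
  have hA0 : 0 ≤ A := by positivity
  refine ⟨A * M, fun r hr => ?_⟩
  have hr0 : 0 < r := by linarith
  have ha : (v : ℂ) + 1 / 2 = ((v + 1 / 2 : ℝ) : ℂ) := by push_cast; rfl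
  set J := ∫ s in Ioi (0 : ℝ), (Real.cos (r * s) : ℂ) *
      ((s : ℂ) ^ 2 + z ^ 2) ^ (-((v + 1 / 2 : ℝ) : ℂ)) with hJ
  have hnorm : ‖besselKC v (r * z)‖ = r ^ (-v) * (A * ‖J‖) := by
    have hK : besselKC v (r * z) = (π : ℂ) ^ (-(1 : ℂ) / 2) * Complex.Gamma ((v : ℂ) + 1 / 2) *
        (2 * (r * z)) ^ (v : ℂ) * (r * ((r ^ 2 : ℝ) : ℂ) ^ (-((v + 1 / 2 : ℝ) : ℂ)) * J) := by
      rw [hJ, ← integral_cos_mul_cpow_comp_mul hz _ hr0, besselKC, ha]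
    rw [hK, norm_mul, norm_mul, norm_cpow_real, norm_mul _ J, norm_mul (r : ℂ), ← ofReal_neg,
      norm_cpow_real, Complex.norm_real, Complex.norm_real, Real.norm_of_nonneg hr0.le,
      Real.norm_of_nonneg (by positivity), mul_left_comm (2 : ℂ), norm_mul (r : ℂ),
      Complex.norm_real, Real.norm_of_nonneg hr0.le, Real.mul_rpow hr0.le (norm_nonneg _),
      ← Real.rpow_natCast, ← Real.rpow_mul hr0.le]
    have hpow : r ^ v * (r * r ^ (((2 : ℕ) : ℝ) * -(v + 1 / 2))) = r ^ (-v) := by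
      nth_rewrite 2 [← Real.rpow_one r]
      rw [← Real.rpow_add hr0, ← Real.rpow_add hr0]
      congr 1
      push_cast
      ring
    rw [← hpow, hA]
    ring
  calc r ^ n * ‖besselKC v (r * z)‖ = r ^ (-v) * (A * (r ^ n * ‖J‖)) := by rw [hnorm]; ring
    _ ≤ 1 * (A * (r ^ n * ‖J‖)) := by
        gcongr
        exact Real.rpow_le_one_of_one_le_of_nonpos hr (by linarith)
    _ ≤ A * M := by
        rw [one_mul]
        gcongr
        exact hM r hr0.le

theorem stmt_11 (v : ℝ) (hv : 0 ≤ v) (z : ℂ) (hz : 0 < z.re) (k : ℕ) :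
    Tendsto (fun r : ℝ => (r : ℂ) ^ k * besselKC v ((r : ℂ) * z)) atTop (nhds 0) := by
  rcases hv.eq_or_lt with rfl | hv
  · refine tendsto_const_nhds.congr' ?_
    filter_upwards [eventually_gt_atTop 0] with r hr
    rw [besselKC_zero (by simpa using mul_pos hr hz), mul_zero]
  · obtain ⟨C, hC⟩ := exists_norm_besselKC_le hv hz (k + 1)
    refine squeeze_zero_norm' (a := fun r : ℝ => C * r⁻¹) ?_
      (by simpa using tendsto_inv_atTop_zero.const_mul C)
    filter_upwards [eventually_ge_atTop 1] with r hr
    have hr0 : 0 < r := by linarith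
    rw [← div_eq_mul_inv, le_div_iff₀ hr0, norm_mul, norm_pow, Complex.norm_real,
      Real.norm_of_nonneg hr0.le]
    refine le_trans (le_of_eq ?_) (hC r hr)
    ring
end
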